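/- arXiv:1310.1988 — 2 statements merged into one kernel-verified Lean document; each statement's English description precedes it below -/
import Mathlib

section
/- Let K be an imaginary quadratic field with ring of integers 𝔒_K, equipped with an embedding K ⊆ ℂ. Let J₁, …, J_r ∈ M₂(𝔒_K) be pairwise commuting 2×2 matrices, each invertible over K, and assume at least one J_i is not diagonalizable. Let u₀, v₀ ∈ ℂ² and let L ⊆ ℂ² be a one-dimensional linear subspace. Then the set of tuples (n₁,…,n_r) ∈ ℕ^r for which J₁^{n₁}⋯J_r^{n_r}·u₀ ∈ v₀ + L belongs to the class 𝒞. -/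
open NumberField

/-- The set of points of `ℕ^r` lying in the subgroup `H` of `ℤ^r`. -/
def natPart {r : ℕ} (H : AddSubgroup (Fin r → ℤ)) : Set (Fin r → ℕ) :=
  {n | (fun i => (n i : ℤ)) ∈ H}

/-- The class `𝒞` of finite unions of sets `γ + (H ∩ ℕ^r)` with `γ ∈ ℕ^r`
and `H` a subgroup of `ℤ^r`. -/
def inC {r : ℕ} (E : Set (Fin r → ℕ)) : Prop :=
  ∃ (ℓ : ℕ) (γ : Fin ℓ → (Fin r → ℕ)) (H : Fin ℓ → AddSubgroup (Fin r → ℤ)),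
    E = ⋃ i, (fun s => γ i + s) '' natPart (H i)

/-- A square matrix over a field is diagonalizable if it is conjugate, by an
invertible matrix, to a diagonal matrix. -/
def Matrix.IsDiagonalizable {n : Type*} [Fintype n] [DecidableEq n]
    {F : Type*} [Field F] (M : Matrix n n F) : Prop :=
  ∃ P : (Matrix n n F)ˣ,
    ((P : Matrix n n F) * M * ((P⁻¹ : (Matrix n n F)ˣ) : Matrix n n F)).IsDiag

/-- A set of points of `ℕ^r` that is saturated for a homomorphism `F` out of `ℤ^r`
and on which `F` takes finitely many values belongs to `𝒞`. -/
theorem inC_of_finite_image {r : ℕ} {G : Type*} [AddCommGroup G] (F : (Fin r → ℤ) →+ G)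
    {E : Set (Fin r → ℕ)}
    (hE : ∀ m ∈ E, ∀ n : Fin r → ℕ, F (fun i => (n i : ℤ)) = F (fun i => (m i : ℤ)) → n ∈ E)
    (hfin : ((fun n : Fin r → ℕ => F (fun i => (n i : ℤ))) '' E).Finite) : inC E := by
  set f : (Fin r → ℕ) → G := fun n => F (fun i => (n i : ℤ)) with hf
  have f_add (m n : Fin r → ℕ) : f (m + n) = f m + f n := by
    rw [hf, ← map_add]
    congr 1
  let T : Set (Fin r → ℕ) := ⋃ g ∈ f '' E, {n | Minimal (fun n => n ∈ E ∧ f n = g) n}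
  have hT : T.Finite := hfin.biUnion fun g _ =>
    WellQuasiOrderedLE.finite_of_isAntichain (setOfPred_minimal_antichain _)
  have hTE {n : Fin r → ℕ} (hn : n ∈ T) : n ∈ E := by
    obtain ⟨g, -, hn⟩ := Set.mem_iUnion₂.1 hn
    exact (Set.mem_ofPred_eq ▸ hn : Minimal _ n).prop.1
  have := hT.to_subtype
  obtain ⟨ℓ, ⟨e⟩⟩ := Finite.exists_equiv_fin T
  refine ⟨ℓ, fun i => (e.symm i : Fin r → ℕ), fun _ => F.ker, ?_⟩
  ext n
  simp only [Set.mem_iUnion, Set.mem_image]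
  constructor
  · intro hn
    obtain ⟨m, hmn, hm⟩ := exists_minimal_le_of_wellFoundedLT
      (fun k => k ∈ E ∧ f k = f n) n ⟨hn, rfl⟩
    have hmT : m ∈ T := Set.mem_iUnion₂.2 ⟨f n, ⟨n, hn, rfl⟩, hm⟩
    refine ⟨e ⟨m, hmT⟩, n - m, ?_, by simpa using add_tsub_cancel_of_le hmn⟩
    change f (n - m) = 0
    have h := f_add m (n - m)
    rw [add_tsub_cancel_of_le hmn, hm.prop.2] at h
    simpa using h
  · rintro ⟨i, k, hk, rfl⟩
    refine hE _ (hTE (e.symm i).2) _ ?_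
    change f _ = f _
    have hk : f k = 0 := hk
    rw [f_add, hk, add_zero]

theorem Matrix.isDiagonalizable_of_charpoly_split {F : Type*} [Field F]
    (M : Matrix (Fin 2) (Fin 2) F) {x y : F} (hxy : x ≠ y)
    (htr : x + y = M 0 0 + M 1 1) (hdet : x * y = M 0 0 * M 1 1 - M 0 1 * M 1 0) :
    M.IsDiagonalizable := by
  have key (P : Matrix (Fin 2) (Fin 2) F) (hP : P.det ≠ 0)
      (h : P * M = Matrix.diagonal ![x, y] * P) : M.IsDiagonalizable := by
    refine ⟨P.nonsingInvUnit (isUnit_iff_ne_zero.2 hP), ?_⟩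
    rw [show (P.nonsingInvUnit (isUnit_iff_ne_zero.2 hP) : Matrix (Fin 2) (Fin 2) F) * M =
      Matrix.diagonal ![x, y] * P.nonsingInvUnit (isUnit_iff_ne_zero.2 hP) from h,
      Units.mul_inv_cancel_right]
    exact Matrix.isDiag_diagonal _
  have hx : x * x = (M 0 0 + M 1 1) * x - (M 0 0 * M 1 1 - M 0 1 * M 1 0) := by
    rw [← htr, ← hdet]; ring
  have hy : y * y = (M 0 0 + M 1 1) * y - (M 0 0 * M 1 1 - M 0 1 * M 1 0) := by
    rw [← htr, ← hdet]; ring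
  by_cases hc : M 1 0 = 0
  · by_cases hb : M 0 1 = 0
    · refine ⟨1, fun i j hij => ?_⟩
      fin_cases i <;> fin_cases j <;> simp_all
    · refine key !![x - M 1 1, M 0 1; y - M 1 1, M 0 1] ?_ ?_
      · rw [Matrix.det_fin_two_of,
          show (x - M 1 1) * M 0 1 - M 0 1 * (y - M 1 1) = (x - y) * M 0 1 by ring]
        exact mul_ne_zero (sub_ne_zero.2 hxy) hb
      · ext i j
        fin_cases i <;> fin_cases j <;>
          simp [Matrix.mul_apply, Fin.sum_univ_two] <;> grind
  · refine key !![M 1 0, x - M 0 0; M 1 0, y - M 0 0] ?_ ?_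
    · rw [Matrix.det_fin_two_of,
        show M 1 0 * (y - M 0 0) - (x - M 0 0) * M 1 0 = (y - x) * M 1 0 by ring]
      exact mul_ne_zero (sub_ne_zero.2 hxy.symm) hc
    · ext i j
      fin_cases i <;> fin_cases j <;>
        simp [Matrix.mul_apply, Fin.sum_univ_two] <;> grind

/-- A `2 × 2` complex matrix that is not diagonalizable has a double eigenvalue. -/
theorem Matrix.discr_eq_zero_of_not_isDiagonalizable (M : Matrix (Fin 2) (Fin 2) ℂ)
    (h : ¬ M.IsDiagonalizable) : (M 0 0 - M 1 1) ^ 2 + 4 * (M 0 1 * M 1 0) = 0 := by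
  by_contra hne
  obtain ⟨s, hs⟩ := IsAlgClosed.exists_pow_nat_eq
    ((M 0 0 - M 1 1) ^ 2 + 4 * (M 0 1 * M 1 0)) two_pos
  have hs0 : s ≠ 0 := by
    rintro rfl
    exact hne (by rw [← hs]; ring)
  refine h (M.isDiagonalizable_of_charpoly_split
    (x := (M 0 0 + M 1 1 + s) / 2) (y := (M 0 0 + M 1 1 - s) / 2) ?_ (by ring) ?_)
  · intro hxy
    apply hs0
    linear_combination hxy
  · linear_combination -hs / 4

/-- A `2 × 2` matrix commuting with a nonscalar matrix `M` with a double eigenvalue is the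
sum of half its trace and a multiple of the nilpotent part of `M`. -/
theorem Matrix.exists_eq_scalar_add_of_commute {F : Type*} [Field F] [CharZero F]
    {M X : Matrix (Fin 2) (Fin 2) F} (hM : M 0 1 ≠ 0 ∨ M 1 0 ≠ 0) (hX : X * M = M * X) :
    ∃ b : F, X = ((X 0 0 + X 1 1) / 2) • (1 : Matrix (Fin 2) (Fin 2) F) +
      b • (M - ((M 0 0 + M 1 1) / 2) • (1 : Matrix (Fin 2) (Fin 2) F)) := by
  have h00 := congrFun₂ hX 0 0
  have h01 := congrFun₂ hX 0 1
  have h10 := congrFun₂ hX 1 0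
  simp only [Matrix.mul_apply, Fin.sum_univ_two] at h00 h01 h10
  rcases hM with h | h
  · refine ⟨X 0 1 / M 0 1, ?_⟩
    ext i j
    fin_cases i <;> fin_cases j <;> simp <;> field_simp <;> grind
  · refine ⟨X 1 0 / M 1 0, ?_⟩
    ext i j
    fin_cases i <;> fin_cases j <;> simp <;> field_simp <;> grind

theorem pow_smul_one_add_smul {R A : Type*} [CommRing R] [Ring A] [Algebra R A] {N : A}
    (hN : N * N = 0) (a c : R) (n : ℕ) :
    (a • (1 + c • N)) ^ n = a ^ n • (1 + (n * c) • N) := by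
  induction n with
  | zero => simp
  | succ n ih =>
    rw [pow_succ, ih, smul_mul_smul_comm, pow_succ]
    congr 1
    simp only [mul_add, add_mul, smul_mul_smul_comm, hN, smul_zero, mul_one, one_mul]
    push_cast
    module

theorem prod_ofFn_smul_one_add_smul {R A : Type*} [CommRing R] [Ring A] [Algebra R A] {N : A}
    (hN : N * N = 0) {r : ℕ} (a c : Fin r → R) (n : Fin r → ℕ) :
    (List.ofFn fun i => (a i • (1 + c i • N)) ^ n i).prod =
      (∏ i, a i ^ n i) • (1 + (∑ i, n i * c i) • N) := by
  induction r with
  | zero => simp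
  | succ r ih =>
    rw [List.ofFn_succ, List.prod_cons, ih (fun i => a i.succ) (fun i => c i.succ)
      (fun i => n i.succ), pow_smul_one_add_smul hN, smul_mul_smul_comm, Fin.prod_univ_succ,
      Fin.sum_univ_succ]
    congr 1
    simp only [mul_add, add_mul, smul_mul_smul_comm, hN, smul_zero, mul_one, one_mul]
    module

section ImaginaryQuadratic

variable {K : Type*} [Field K] [NumberField K]

/-- All complex embeddings of an imaginary quadratic field induce the same absolute value. -/
theorem norm_embedding_eq (hdeg : Module.finrank ℚ K = 2) (himag : ∀ _ : K →+* ℝ, False)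
    (φ ψ : K →+* ℂ) (x : K) : ‖ψ x‖ = ‖φ x‖ := by
  classical
  have hne : φ ≠ ComplexEmbedding.conjugate φ := fun h =>
    himag (ComplexEmbedding.IsReal.embedding (ComplexEmbedding.isReal_iff.2 h.symm))
  have huniv : ({φ, ComplexEmbedding.conjugate φ} : Finset (K →+* ℂ)) = Finset.univ := by
    apply Finset.eq_univ_of_card
    rw [Finset.card_pair hne, Embeddings.card K ℂ, hdeg]
  have hψ := Finset.mem_univ ψ
  rw [← huniv, Finset.mem_insert, Finset.mem_singleton] at hψ
  rcases hψ with rfl | rfl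
  · rfl
  · simp [ComplexEmbedding.conjugate_coe_eq]

theorem finite_integral_norm_le (hdeg : Module.finrank ℚ K = 2) (himag : ∀ _ : K →+* ℝ, False)
    (φ : K →+* ℂ) (B : ℝ) : {x : K | IsIntegral ℤ x ∧ ‖φ x‖ ≤ B}.Finite :=
  (Embeddings.finite_of_norm_le K ℂ B).subset fun x hx =>
    ⟨hx.1, fun ψ => (norm_embedding_eq hdeg himag φ ψ x).trans_le hx.2⟩

theorem one_le_norm_of_isIntegral (hdeg : Module.finrank ℚ K = 2)
    (himag : ∀ _ : K →+* ℝ, False) (φ : K →+* ℂ) {x : K} (hx : IsIntegral ℤ x) (hx0 : x ≠ 0) :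
    1 ≤ ‖φ x‖ := by
  by_contra! hlt
  obtain ⟨n, hn, h⟩ := Embeddings.pow_eq_one_of_norm_le_one K ℂ hx0 hx
    fun ψ => (norm_embedding_eq hdeg himag φ ψ x).trans_le hlt.le
  have h1 : ‖φ x‖ ^ n = 1 := by rw [← norm_pow, ← map_pow, h, map_one, norm_one]
  exact (pow_lt_one₀ (norm_nonneg _) hlt hn.ne').ne h1

/-- The bounded values of a linear form with coefficients in `K` at points of `ℕ^r` form a
finite set. -/
theorem finite_linear_values_norm_le (hdeg : Module.finrank ℚ K = 2)
    (himag : ∀ _ : K →+* ℝ, False) (φ : K →+* ℂ) {r : ℕ} (c : Fin r → K) (B : ℝ) :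
    {s : ℂ | ‖s‖ ≤ B ∧ ∃ n : Fin r → ℕ, s = ∑ i, n i * φ (c i)}.Finite := by
  obtain ⟨d, hd⟩ := IsLocalization.exist_integer_multiples_of_finite
    (nonZeroDivisors (RingOfIntegers K)) c
  set D : K := algebraMap (RingOfIntegers K) K d with hD
  have hD0 : D ≠ 0 := by
    simp [hD]
  refine ((finite_integral_norm_le hdeg himag φ (‖φ D‖ * B)).image
    fun x => φ x / φ D).subset ?_
  rintro s ⟨hs, n, rfl⟩
  have hint (i : Fin r) : IsIntegral ℤ (D * c i) := by
    obtain ⟨y, hy⟩ := hd i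
    rw [Algebra.smul_def] at hy
    exact hy ▸ RingOfIntegers.isIntegral_coe y
  have hval : φ (∑ i, n i * (D * c i)) = φ D * ∑ i, n i * φ (c i) := by
    simp only [map_sum, map_mul, map_natCast, Finset.mul_sum]
    exact Finset.sum_congr rfl fun i _ => by ring
  refine ⟨∑ i, n i * (D * c i), ⟨?_, ?_⟩, ?_⟩
  · exact IsIntegral.sum _ fun i _ => (isIntegral_natCast (n i)).mul (hint i)
  · rw [hval, norm_mul]
    gcongr
  · simp only [hval]
    exact mul_div_cancel_left₀ _ (by simpa using hD0)

/-- The solution set of a mixed exponential-linear equation in an imaginary quadratic field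
belongs to `𝒞`. -/
theorem inC_exponential_linear (hdeg : Module.finrank ℚ K = 2) (himag : ∀ _ : K →+* ℝ, False)
    (φ : K →+* ℂ) {r : ℕ} (a c : Fin r → K) (ha : ∀ i, IsIntegral ℤ (a i))
    (ha0 : ∀ i, a i ≠ 0) (A B C : ℂ) :
    inC {n : Fin r → ℕ | (∏ i, φ (a i) ^ n i) * (A + (∑ i, n i * φ (c i)) * B) = C} := by
  have hφ0 (i : Fin r) : φ (a i) ≠ 0 := by simpa using ha0 i
  have hprod0 (n : Fin r → ℕ) : ∏ i, φ (a i) ^ n i ≠ 0 :=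
    Finset.prod_ne_zero_iff.2 fun i _ => pow_ne_zero _ (hφ0 i)
  let S : (Fin r → ℤ) →+ ℂ := AddMonoidHom.mk' (fun n => ∑ i, n i * φ (c i)) fun m n => by
    simp [add_mul, Finset.sum_add_distrib]
  let P : (Fin r → ℤ) →+ Additive ℂˣ := AddMonoidHom.mk'
    (fun n => Additive.ofMul (∏ i, Units.mk0 (φ (a i)) (hφ0 i) ^ n i)) fun m n => by
      simp [zpow_add, Finset.prod_mul_distrib]
  have hS (n : Fin r → ℕ) : S (fun i => (n i : ℤ)) = ∑ i, n i * φ (c i) := by simp [S]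
  have hP (n : Fin r → ℕ) :
      ((P (fun i => (n i : ℤ))).toMul : ℂ) = ∏ i, φ (a i) ^ n i := by simp [P]
  by_cases hC : C = 0
  · have hmem (n : Fin r → ℕ) : (∏ i, φ (a i) ^ n i) * (A + (∑ i, n i * φ (c i)) * B) = C ↔
        A + S (fun i => (n i : ℤ)) * B = 0 := by
      rw [hC, mul_eq_zero, or_iff_right (hprod0 n), hS]
    simp only [hmem]
    by_cases hB : B = 0
    · simp only [hB, mul_zero, add_zero]
      exact inC_of_finite_image (0 : (Fin r → ℤ) →+ ℂ) (fun m hm n _ => hm)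
        ((Set.finite_singleton 0).subset (by rintro _ ⟨n, -, rfl⟩; simp))
    · refine inC_of_finite_image S (fun m hm n h => ?_)
        ((Set.finite_singleton (-A / B)).subset ?_)
      · simpa only [Set.mem_ofPred_eq, h] using hm
      · rintro _ ⟨n, hn, rfl⟩
        rw [Set.mem_singleton_iff, eq_div_iff hB]
        exact eq_neg_of_add_eq_zero_right hn
  have hnorm (n : Fin r → ℕ) : 1 ≤ ‖∏ i, φ (a i) ^ n i‖ := by
    rw [norm_prod]
    refine Finset.one_le_prod fun i _ => ?_
    rw [norm_pow]
    exact one_le_pow₀ (one_le_norm_of_isIntegral hdeg himag φ (ha i) (ha0 i))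
  by_cases hB : B = 0
  · refine inC_of_finite_image P (fun m hm n h => ?_) ?_
    · simp only [Set.mem_ofPred_eq, hB, mul_zero, add_zero, ← hP] at hm ⊢
      rwa [h]
    · refine Set.Subsingleton.finite ?_
      rintro _ ⟨m, hm, rfl⟩ _ ⟨n, hn, rfl⟩
      simp only [Set.mem_ofPred_eq, hB, mul_zero, add_zero, ← hP] at hm hn
      have hA : A ≠ 0 := by
        rintro rfl
        exact hC (by simpa using hm.symm)
      exact Additive.toMul.injective (Units.ext (mul_right_cancel₀ hA (hm.trans hn.symm)))
  · refine inC_of_finite_image (S.prod P) (fun m hm n h => ?_) ?_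
    · simp only [AddMonoidHom.prod_apply, Prod.mk.injEq] at h
      simp only [Set.mem_ofPred_eq, ← hP, ← hS] at hm ⊢
      rwa [h.1, h.2]
    · have hfin := finite_linear_values_norm_le hdeg himag φ c ((‖C‖ + ‖A‖) / ‖B‖)
      refine Set.Finite.of_finite_image (f := Prod.fst) (hfin.subset ?_) ?_
      · rintro _ ⟨_, ⟨n, hn, rfl⟩, rfl⟩
        simp only [AddMonoidHom.prod_apply, hS]
        refine ⟨?_, n, rfl⟩
        rw [le_div_iff₀ (norm_pos_iff.2 hB), ← norm_mul]
        set s := (∑ i, n i * φ (c i)) * B with hs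
        have hle : ‖A + s‖ ≤ ‖C‖ := by
          rw [← show (∏ i, φ (a i) ^ n i) * (A + s) = C from hn, norm_mul]
          exact le_mul_of_one_le_left (norm_nonneg _) (hnorm n)
        calc ‖s‖ = ‖A + s - A‖ := by rw [add_sub_cancel_left]
          _ ≤ ‖A + s‖ + ‖A‖ := norm_sub_le _ _
          _ ≤ ‖C‖ + ‖A‖ := by gcongr
      · rintro _ ⟨m, hm, rfl⟩ _ ⟨n, hn, rfl⟩ h
        simp only [AddMonoidHom.prod_apply] at h
        simp only [Set.mem_ofPred_eq, ← hP, ← hS] at hm hn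
        rw [← h] at hn
        have h0 : A + S (fun i => (m i : ℤ)) * B ≠ 0 := by
          intro h0
          rw [h0, mul_zero] at hm
          exact hC hm.symm
        exact Prod.ext h
          (Additive.toMul.injective (Units.ext (mul_right_cancel₀ h0 (hm.trans hn.symm))))

end ImaginaryQuadratic

/-- Let `K` be an imaginary quadratic field with ring of integers `𝔒_K`,
embedded into `ℂ` via `φ`. Let `J₁, …, J_r ∈ M₂(𝔒_K)` be pairwise commuting
matrices, invertible over `K`, at least one of which is not diagonalizable.
Let `u₀, v₀ ∈ ℂ²` and let `L ⊆ ℂ²` be a one-dimensional subspace. Then the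
set of tuples `(n₁,…,n_r) ∈ ℕ^r` with `J₁^{n₁}⋯J_r^{n_r}·u₀ ∈ v₀ + L`
belongs to the class `𝒞`. -/
theorem nondiagonalizable_case_in_C (K : Type*) [Field K] [NumberField K]
    (hdeg : Module.finrank ℚ K = 2) (himag : ∀ ψ : K →+* ℝ, False)
    (φ : K →+* ℂ) (r : ℕ)
    (J : Fin r → Matrix (Fin 2) (Fin 2) (RingOfIntegers K))
    (hcomm : ∀ i j, Commute (J i) (J j))
    (hinv : ∀ i, IsUnit ((J i).map (algebraMap (RingOfIntegers K) K)))
    (i₀ : Fin r)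
    (hnd : ¬ ((J i₀).map
        (φ.comp (algebraMap (RingOfIntegers K) K))).IsDiagonalizable)
    (u₀ v₀ : Fin 2 → ℂ) (L : Submodule ℂ (Fin 2 → ℂ))
    (hL : Module.finrank ℂ L = 1) :
    inC {n : Fin r → ℕ |
      ((List.ofFn fun i =>
          ((J i).map (φ.comp (algebraMap (RingOfIntegers K) K))) ^ n i).prod
        ).mulVec u₀ - v₀ ∈ L} := by
  set X : Fin r → Matrix (Fin 2) (Fin 2) K :=
    fun i => (J i).map (algebraMap (RingOfIntegers K) K) with hX
  have hXφ (i : Fin r) :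
      (J i).map (φ.comp (algebraMap (RingOfIntegers K) K)) = (X i).map φ := rfl
  simp only [hXφ] at hnd ⊢
  have hXcomm (i : Fin r) : X i * X i₀ = X i₀ * X i := by
    simp only [hX, ← Matrix.map_mul, (hcomm i i₀).eq]
  have hdisc : (X i₀ 0 0 - X i₀ 1 1) ^ 2 + 4 * (X i₀ 0 1 * X i₀ 1 0) = 0 := by
    apply φ.injective
    simpa [map_ofNat φ 4] using Matrix.discr_eq_zero_of_not_isDiagonalizable _ hnd
  have hoff : X i₀ 0 1 ≠ 0 ∨ X i₀ 1 0 ≠ 0 := by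
    by_contra! h
    refine hnd ⟨1, fun i j hij => ?_⟩
    fin_cases i <;> fin_cases j <;> simp_all
  choose b hb using fun i => Matrix.exists_eq_scalar_add_of_commute hoff (hXcomm i)
  set N := X i₀ - ((X i₀ 0 0 + X i₀ 1 1) / 2) • (1 : Matrix (Fin 2) (Fin 2) K) with hN
  set a : Fin r → K := fun i => (X i 0 0 + X i 1 1) / 2 with ha
  have hNN : N * N = 0 := by
    ext i j
    fin_cases i <;> fin_cases j <;> simp [hN, Matrix.mul_apply, Fin.sum_univ_two] <;> grind
  have hNdet : N 0 0 + N 1 1 = 0 ∧ N 0 0 * N 1 1 - N 0 1 * N 1 0 = 0 := by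
    constructor <;> simp [hN] <;> grind
  have hdet (i : Fin r) : a i ^ 2 = (X i).det := by
    rw [hb i, Matrix.det_fin_two]
    simp
    linear_combination (-a i * b i) * hNdet.1 - b i ^ 2 * hNdet.2
  have ha0 (i : Fin r) : a i ≠ 0 := by
    intro h
    have := ((Matrix.isUnit_iff_isUnit_det _).1 (hinv i)).ne_zero
    exact this (by rw [← hdet i, h]; simp)
  have haint (i : Fin r) : IsIntegral ℤ (a i) := by
    refine IsIntegral.of_pow two_pos ?_
    rw [hdet i, Matrix.det_fin_two]
    exact ((RingOfIntegers.isIntegral_coe _).mul (RingOfIntegers.isIntegral_coe _)).sub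
      ((RingOfIntegers.isIntegral_coe _).mul (RingOfIntegers.isIntegral_coe _))
  set N' : Matrix (Fin 2) (Fin 2) ℂ := N.map φ with hN'
  have hNN' : N' * N' = 0 := by
    rw [hN', ← Matrix.map_mul, hNN]
    simp
  have hXform (i : Fin r) :
      (X i).map φ = φ (a i) • (1 + φ (b i / a i) • N') := by
    have hφ0 : φ (a i) ≠ 0 := by simpa using ha0 i
    have hXi : X i = a i • (1 : Matrix (Fin 2) (Fin 2) K) + b i • N := hb i
    clear_value a
    rw [hXi, smul_add, smul_smul, map_div₀ φ, mul_div_cancel₀ _ hφ0]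
    ext j k
    simp [hN', Matrix.one_apply, apply_ite φ]
  have hquot : Module.finrank ℂ ((Fin 2 → ℂ) ⧸ L) = Module.finrank ℂ ℂ := by
    have := L.finrank_quotient_add_finrank
    rw [hL, Module.finrank_fin_fun] at this
    rw [Module.finrank_self]
    omega
  let q : (Fin 2 → ℂ) →ₗ[ℂ] ℂ :=
    (LinearEquiv.ofFinrankEq _ _ hquot).toLinearMap ∘ₗ L.mkQ
  have hq (v : Fin 2 → ℂ) : v ∈ L ↔ q v = 0 := by simp [q]
  have key := inC_exponential_linear hdeg himag φ a (fun i => b i / a i) haint ha0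
    (q u₀) (q (N'.mulVec u₀)) (q v₀)
  convert! key using 3 with n
  rw [hq, map_sub, sub_eq_zero]
  simp only [hXform]
  rw [prod_ofFn_smul_one_add_smul hNN', Matrix.smul_mulVec, Matrix.add_mulVec,
    Matrix.one_mulVec, Matrix.smul_mulVec]
  simp only [map_smul, map_add, smul_eq_mul]
end

section
/- The set {(2^k, k) : k ∈ ℕ} ⊆ ℕ² does not belong to the class 𝒞. -/
theorem add_mem_natPart {r : ℕ} {H : AddSubgroup (Fin r → ℤ)} {s t : Fin r → ℕ}
    (hs : s ∈ natPart H) (ht : t ∈ natPart H) : s + t ∈ natPart H := by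
  have h : (fun i => ((s + t) i : ℤ)) = (fun i => (s i : ℤ)) + fun i => (t i : ℤ) := by
    ext i
    simp
  change (fun i => ((s + t) i : ℤ)) ∈ H
  rw [h]
  exact H.add_mem hs ht

theorem zero_mem_natPart {r : ℕ} (H : AddSubgroup (Fin r → ℤ)) : 0 ∈ natPart H :=
  H.zero_mem

/-- A set of class `𝒞` without nontrivial three-term arithmetic progressions is finite. -/
theorem inC.finite_of_threeAPFree {r : ℕ} {E : Set (Fin r → ℕ)} (hE : inC E)
    (hfree : ThreeAPFree E) : E.Finite := by
  obtain ⟨ℓ, γ, H, rfl⟩ := hE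
  refine (Set.finite_range γ).subset fun p hp => ?_
  obtain ⟨i, s, hs, rfl⟩ := Set.mem_iUnion.1 hp
  have mem {t : Fin r → ℕ} (ht : t ∈ natPart (H i)) :
      γ i + t ∈ ⋃ j, (fun s => γ j + s) '' natPart (H j) :=
    Set.mem_iUnion.2 ⟨i, t, ht, rfl⟩
  have h := hfree (mem (zero_mem_natPart _)) (mem hs) (mem (add_mem_natPart hs hs)) (by abel)
  exact ⟨i, by simpa using h⟩

theorem threeAPFree_exponential_set :
    ThreeAPFree {p : Fin 2 → ℕ | ∃ k : ℕ, p 0 = 2 ^ k ∧ p 1 = k} := by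
  rintro a ⟨i, ha₀, ha₁⟩ b ⟨j, hb₀, hb₁⟩ c ⟨k, hc₀, hc₁⟩ habc
  have h₀ : 2 ^ i + 2 ^ k = 2 ^ j + 2 ^ j := by
    simpa [ha₀, hb₀, hc₀] using congrFun habc 0
  have h₁ : i + k = j + j := by
    simpa [ha₁, hb₁, hc₁] using congrFun habc 1
  have hmul : (2 : ℤ) ^ i * 2 ^ k = 2 ^ j * 2 ^ j := by
    rw [← pow_add, ← pow_add, h₁]
  have hadd : (2 : ℤ) ^ i + 2 ^ k = 2 ^ j + 2 ^ j := by exact_mod_cast h₀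
  have hsq : ((2 : ℤ) ^ i - 2 ^ j) ^ 2 = 0 := by
    linear_combination (2 : ℤ) ^ i * hadd - hmul
  have hpow : 2 ^ i = 2 ^ j := by
    exact_mod_cast sub_eq_zero.1 (pow_eq_zero_iff two_ne_zero |>.1 hsq)
  have hij : i = j := Nat.pow_right_injective le_rfl hpow
  ext x
  fin_cases x
  · simp [ha₀, hb₀, hij]
  · simp [ha₁, hb₁, hij]

theorem infinite_exponential_set :
    {p : Fin 2 → ℕ | ∃ k : ℕ, p 0 = 2 ^ k ∧ p 1 = k}.Infinite :=
  Set.infinite_of_injective_forall_mem (f := fun k : ℕ => ![2 ^ k, k])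
    (fun _ _ h => by simpa using congrFun h 1) fun k => ⟨k, by simp⟩

/-- The set `{(2^k, k) : k ∈ ℕ} ⊆ ℕ²` does not belong to the class `𝒞`. -/
theorem exponential_set_not_in_C :
    ¬ inC {p : Fin 2 → ℕ | ∃ k : ℕ, p 0 = 2 ^ k ∧ p 1 = k} :=
  fun h => infinite_exponential_set (h.finite_of_threeAPFree threeAPFree_exponential_set)
end
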